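/- arXiv:1605.05626 — 2 statements merged into one kernel-verified Lean document; each statement's English description precedes it below -/
import Mathlib

section
/- There exists a nonzero polynomial P in the n² matrix entries such that every n×n complex matrix A with P(A) ≠ 0 can be written as a product of n upper bidiagonal matrices followed by n lower bidiagonal matrices (in particular, a product of 2n bidiagonal matrices). -/
/-- An `n×n` matrix is upper bidiagonal: `A i j = 0` whenever `|i - j| ≥ 2` or `i > j`. -/
def IsUpperBidiagonal (n : ℕ) (A : Matrix (Fin n) (Fin n) ℂ) : Prop :=
  ∀ i j : Fin n, ((j : ℤ) - (i : ℤ)).natAbs ≥ 2 ∨ j < i → A i j = 0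

/-- An `n×n` matrix is lower bidiagonal if its transpose is upper bidiagonal. -/
def IsLowerBidiagonal (n : ℕ) (A : Matrix (Fin n) (Fin n) ℂ) : Prop :=
  IsUpperBidiagonal n A.transpose

open Matrix

/-- The minors of `N` on consecutive rows `i, …, i + k - 1` with `t ≤ i` and on columns
`t, …, t + k - 1` do not vanish. -/
def ConsecutiveMinorsNeZero {n : ℕ} (t : ℕ) (N : Matrix (Fin n) (Fin n) ℂ) : Prop :=
  ∀ (k i : ℕ) (r c : Fin k → Fin n), t ≤ i → (∀ a, (r a : ℕ) = i + a) →
    (∀ a, (c a : ℕ) = t + a) → (N.submatrix r c).det ≠ 0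

theorem IsUpperBidiagonal.blockTriangular {n : ℕ} {A : Matrix (Fin n) (Fin n) ℂ}
    (hA : IsUpperBidiagonal n A) : A.BlockTriangular id :=
  fun _ _ hij => hA _ _ (Or.inr hij)

theorem IsLowerBidiagonal.diagonal_mul {n : ℕ} {A : Matrix (Fin n) (Fin n) ℂ}
    (hA : IsLowerBidiagonal n A) (d : Fin n → ℂ) : IsLowerBidiagonal n (diagonal d * A) := by
  intro i j hij
  have h : A j i = 0 := hA i j hij
  simp [Matrix.transpose_apply, Matrix.diagonal_mul, h]

/-- The matrix of the row operation that subtracts from each row `i > t` the multiple of row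
`i - 1` which cancels the entry of `N` in column `t`. -/
noncomputable def nevilleStep {n : ℕ} (N : Matrix (Fin n) (Fin n) ℂ) (t : Fin n) :
    Matrix (Fin n) (Fin n) ℂ :=
  1 + of fun i j : Fin n => if (i : ℕ) = j + 1 ∧ t < i then -(N i t / N j t) else 0

theorem nevilleStep_isLowerBidiagonal {n : ℕ} (N : Matrix (Fin n) (Fin n) ℂ) (t : Fin n) :
    IsLowerBidiagonal n (nevilleStep N t) := by
  intro i j hij
  have h1 : j ≠ i := by rintro rfl; simp at hij
  have h2 : ¬ ((j : ℕ) = i + 1 ∧ t < j) := by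
    rintro ⟨h, -⟩
    rcases hij with hij | hij
    · omega
    · have : (j : ℕ) < i := hij
      omega
  simp [nevilleStep, Matrix.one_apply_ne h1, h2]

theorem nevilleStep_det {n : ℕ} (N : Matrix (Fin n) (Fin n) ℂ) (t : Fin n) :
    (nevilleStep N t).det = 1 := by
  rw [← det_transpose,
    det_of_isUpperTriangular (nevilleStep_isLowerBidiagonal N t).blockTriangular]
  simp [nevilleStep]

theorem nevilleStep_mul_apply_of_le {n : ℕ} (N : Matrix (Fin n) (Fin n) ℂ) {t i : Fin n}
    (hi : i ≤ t) (j : Fin n) : (nevilleStep N t * N) i j = N i j := by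
  simp [nevilleStep, Matrix.mul_apply, Matrix.one_apply, not_lt.2 hi]

theorem nevilleStep_mul_apply_succ {n : ℕ} (N : Matrix (Fin n) (Fin n) ℂ) {t i p : Fin n}
    (hp : (i : ℕ) = p + 1) (ht : t ≤ p) (j : Fin n) :
    (nevilleStep N t * N) i j = N i j - N i t / N p t * N p j := by
  have hti : t < i := by
    have : (t : ℕ) ≤ p := ht
    exact Fin.lt_def.2 (by omega)
  rw [nevilleStep, add_mul, one_mul, Matrix.add_apply, Matrix.mul_apply,
    Finset.sum_eq_single p]
  · simp [hp, hti, sub_eq_add_neg]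
  · intro b _ hb
    have : ¬ (i : ℕ) = b + 1 := fun h => hb (Fin.ext (by omega))
    simp [this]
  · simp

theorem ConsecutiveMinorsNeZero.apply_ne_zero {n : ℕ} {N : Matrix (Fin n) (Fin n) ℂ}
    {t i : Fin n} (hN : ConsecutiveMinorsNeZero t N) (hi : t ≤ i) : N i t ≠ 0 := by
  simpa using hN 1 i (fun _ => i) (fun _ => t) hi (by simp) (by simp)

theorem ConsecutiveMinorsNeZero.nevilleStep_mul {n : ℕ} {N : Matrix (Fin n) (Fin n) ℂ}
    {t : Fin n} (hN : ConsecutiveMinorsNeZero t N) :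
    ConsecutiveMinorsNeZero (t + 1) (nevilleStep N t * N) := by
  intro k i r c hti hr hc
  rcases k with _ | m
  · simp
  have hin : i < n := by have := hr 0; have := (r 0).isLt; simp at *; omega
  obtain ⟨q, rfl⟩ : ∃ q, i = q + 1 := ⟨i - 1, by omega⟩
  let p : Fin n := ⟨q, by omega⟩
  have htp : t ≤ p := Fin.le_def.2 (by simp only [p]; omega)
  let R : Fin (m + 2) → Fin n := Fin.cons p r
  let C : Fin (m + 2) → Fin n := Fin.cons t c
  have hR : ∀ a, (R a : ℕ) = q + a := by
    intro a
    refine Fin.cases ?_ (fun a => ?_) a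
    · simp [R, p]
    · simp [R, hr]; omega
  have hC : ∀ a, (C a : ℕ) = t + a := by
    intro a
    refine Fin.cases ?_ (fun a => ?_) a
    · simp [C]
    · simp [C, hc]; omega
  have hdet := hN (m + 2) q R C (by omega) hR hC
  have hstep : ∀ (a : Fin (m + 1)) (j : Fin n), (nevilleStep N t * N) (r a) j =
      N (r a) j - N (r a) t / N (R a.castSucc) t * N (R a.castSucc) j := by
    intro a j
    have h1 := hr a
    have h2 := hR a.castSucc
    simp only [Fin.val_castSucc] at h2
    exact nevilleStep_mul_apply_succ N (by omega) (Fin.le_def.2 (by omega)) j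
  let B : Matrix (Fin (m + 2)) (Fin (m + 2)) ℂ := of fun a b =>
    Fin.cases (N p (C b)) (fun a' => (nevilleStep N t * N) (r a') (C b)) a
  have hB : (N.submatrix R C).det = B.det := by
    refine det_eq_of_forall_row_eq_smul_add_pred
      (fun a => N (r a) t / N (R a.castSucc) t) (fun j => ?_) (fun a j => ?_)
    · simp [B, R]
    · simp [B, R, hstep]
  have hB0 : ∀ a : Fin (m + 1), B a.succ 0 = 0 := by
    intro a
    have hne : N (R a.castSucc) t ≠ 0 := by
      refine hN.apply_ne_zero (Fin.le_def.2 ?_)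
      have h2 := hR a.castSucc
      omega
    simp only [B, of_apply, Fin.cases_succ, C, Fin.cons_zero, hstep]
    field_simp
    ring
  rw [hB, det_succ_column_zero, Fin.sum_univ_succ] at hdet
  simp only [hB0, mul_zero, zero_mul, Finset.sum_const_zero, add_zero] at hdet
  exact right_ne_zero_of_mul hdet

theorem exists_neville_elimination {n : ℕ} {N : Matrix (Fin n) (Fin n) ℂ}
    (hN : ConsecutiveMinorsNeZero 0 N) (t : ℕ) (ht : t ≤ n) :
    ∃ f : Fin t → Matrix (Fin n) (Fin n) ℂ, (∀ i, IsLowerBidiagonal n (f i)) ∧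
      (List.ofFn f).prod.det ≠ 0 ∧
      (∀ i j : Fin n, (j : ℕ) < t → j < i → ((List.ofFn f).prod * N) i j = 0) ∧
      ConsecutiveMinorsNeZero t ((List.ofFn f).prod * N) := by
  induction t with
  | zero => exact ⟨Fin.elim0, fun i => i.elim0, by simp, by simp, by simpa using hN⟩
  | succ t ih =>
    obtain ⟨f, hf, hdet, hzero, hminors⟩ := ih (by omega)
    set M := (List.ofFn f).prod * N with hM
    let s : Fin n := ⟨t, by omega⟩
    have hs : ConsecutiveMinorsNeZero s M := hminors
    refine ⟨Fin.cons (nevilleStep M s) f, ?_, ?_⟩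
    · intro i
      refine Fin.cases ?_ (fun i => ?_) i
      · simpa using nevilleStep_isLowerBidiagonal M s
      · simpa using hf i
    · have hprod : (List.ofFn (Fin.cons (nevilleStep M s) f :
          Fin (t + 1) → Matrix (Fin n) (Fin n) ℂ)).prod =
          nevilleStep M s * (List.ofFn f).prod := by simp [List.ofFn_succ]
      rw [hprod, Matrix.mul_assoc, ← hM, det_mul, nevilleStep_det, one_mul]
      refine ⟨hdet, fun i j hj hji => ?_, hs.nevilleStep_mul⟩
      have hji' : (j : ℕ) < i := hji
      rcases le_or_gt i s with his | his
      · rw [nevilleStep_mul_apply_of_le M his]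
        have : (i : ℕ) ≤ t := his
        exact hzero i j (by omega) hji
      · have hti : t < (i : ℕ) := his
        let p : Fin n := ⟨i - 1, by omega⟩
        have hp : (p : ℕ) = i - 1 := rfl
        have hsp : s ≤ p := Fin.le_def.2 (by simp only [s, hp]; omega)
        rw [nevilleStep_mul_apply_succ M (p := p) (by omega) hsp]
        rcases Nat.lt_succ_iff_lt_or_eq.1 hj with hjt | hjt
        · rw [hzero i j hjt hji, hzero p j hjt (Fin.lt_def.2 (by omega))]
          simp
        · obtain rfl : j = s := Fin.ext hjt
          rw [div_mul_cancel₀ _ (hs.apply_ne_zero hsp), sub_self]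

/-- Neville elimination: a matrix with nonvanishing initial consecutive minors is brought to
upper triangular form by `n` lower bidiagonal matrices. -/
theorem exists_lowerBidiagonal_mul_blockTriangular {n : ℕ} {N : Matrix (Fin n) (Fin n) ℂ}
    (hN : ConsecutiveMinorsNeZero 0 N) :
    ∃ f : Fin n → Matrix (Fin n) (Fin n) ℂ, (∀ i, IsLowerBidiagonal n (f i)) ∧
      (List.ofFn f).prod.det ≠ 0 ∧ ((List.ofFn f).prod * N).BlockTriangular id := by
  obtain ⟨f, hf, hdet, hzero, -⟩ := exists_neville_elimination hN n le_rfl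
  exact ⟨f, hf, hdet, fun i j hij => hzero i j j.isLt hij⟩

theorem transpose_prod_ofFn {n t : ℕ} (f : Fin t → Matrix (Fin n) (Fin n) ℂ) :
    (List.ofFn f).prodᵀ = (List.ofFn fun i => (f i.rev)ᵀ).prod := by
  rw [transpose_list_prod]
  congr 1
  apply List.ext_getElem
  · simp
  · intro i h1 h2
    simp only [List.length_ofFn] at h2
    simp only [List.getElem_reverse, List.getElem_map, List.getElem_ofFn, List.length_map,
      List.length_ofFn]
    congr 2
    apply Fin.ext
    simp only [Fin.val_rev]
    omega

theorem transpose_prod_blockTriangular {n t : ℕ} {f : Fin t → Matrix (Fin n) (Fin n) ℂ}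
    (hf : ∀ i, IsLowerBidiagonal n (f i)) : (List.ofFn f).prodᵀ.BlockTriangular id := by
  induction t with
  | zero => simpa using blockTriangular_one
  | succ t ih =>
    rw [List.ofFn_succ, List.prod_cons, transpose_mul]
    exact (ih fun i => hf i.succ).mul (hf 0).blockTriangular

theorem exists_bidiagonal_factorization {n : ℕ} {A : Matrix (Fin n) (Fin n) ℂ}
    (hA : A.det ≠ 0) (h : ConsecutiveMinorsNeZero 0 A.adjugate)
    (h' : ConsecutiveMinorsNeZero 0 A.adjugateᵀ) :
    ∃ f g : Fin n → Matrix (Fin n) (Fin n) ℂ,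
      (∀ i, IsUpperBidiagonal n (f i)) ∧ (∀ i, IsLowerBidiagonal n (g i)) ∧
      A = (List.ofFn f).prod * (List.ofFn g).prod := by
  obtain ⟨g, hg, hgdet, hgtri⟩ := exists_lowerBidiagonal_mul_blockTriangular h
  obtain ⟨f, hf, hfdet, hftri⟩ := exists_lowerBidiagonal_mul_blockTriangular h'
  set L := (List.ofFn g).prod with hL
  set V := (List.ofFn f).prod with hV
  set C := A.adjugate with hC
  have hCA : C * A = A.det • 1 := adjugate_mul A
  have hCdet : C.det ≠ 0 := by rw [hC, det_adjugate]; exact pow_ne_zero _ hA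
  have hup : (L * C * Vᵀ).BlockTriangular id := hgtri.mul (transpose_prod_blockTriangular hf)
  have hlow : (L * C * Vᵀ)ᵀ.BlockTriangular id := by
    rw [transpose_mul, transpose_mul, transpose_transpose, ← Matrix.mul_assoc]
    exact hftri.mul (transpose_prod_blockTriangular hg)
  have hdiag : diagonal (L * C * Vᵀ).diag = L * C * Vᵀ := by
    refine IsDiag.diagonal_diag fun i j hij => ?_
    rcases lt_or_gt_of_ne hij with hij | hij
    · exact hlow hij
    · exact hup hij
  set d := (L * C * Vᵀ).diag with hd
  have hd0 : ∀ i, d i ≠ 0 := by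
    have hdet : (diagonal d).det ≠ 0 := by
      rw [hdiag, det_mul, det_mul, det_transpose]
      exact mul_ne_zero (mul_ne_zero hgdet hCdet) hfdet
    rw [det_diagonal, Finset.prod_ne_zero_iff] at hdet
    exact fun i => hdet i (Finset.mem_univ i)
  have hunit : IsUnit (L * C) := by
    rw [isUnit_iff_isUnit_det, det_mul]
    exact (mul_ne_zero hgdet hCdet).isUnit
  have hfac : A = Vᵀ * (diagonal (fun i => (d i)⁻¹ * A.det) * L) := by
    apply hunit.mul_left_cancel
    have hinv : diagonal d * diagonal (fun i => (d i)⁻¹ * A.det) = A.det • 1 := by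
      rw [diagonal_mul_diagonal, smul_one_eq_diagonal]
      congr 1
      funext i
      rw [mul_inv_cancel_left₀ (hd0 i)]
    rw [Matrix.mul_assoc, hCA, ← Matrix.mul_assoc (L * C), ← hdiag, ← Matrix.mul_assoc, hinv]
    simp
  rcases n with _ | m
  · exact ⟨Fin.elim0, Fin.elim0, fun i => i.elim0, fun i => i.elim0, Subsingleton.elim _ _⟩
  · refine ⟨fun i => (f i.rev)ᵀ,
      Fin.cons (diagonal (fun i => (d i)⁻¹ * A.det) * g 0) fun i => g i.succ,
      fun i => hf i.rev, fun i => ?_, ?_⟩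
    · refine Fin.cases ?_ (fun i => ?_) i
      · simpa using (hg 0).diagonal_mul _
      · simpa using hg i.succ
    · rw [← transpose_prod_ofFn, ← hV]
      conv_lhs => rw [hfac, hL]
      simp [List.ofFn_succ, Matrix.mul_assoc]

/-- The product of the minors of `N` on its leading columns. -/
noncomputable def prodLeadingColumnMinors {R : Type*} [CommRing R] {n : ℕ}
    (N : Matrix (Fin n) (Fin n) R) : R :=
  ∏ k : Fin (n + 1), ∏ r : Fin k ↪ Fin n,
    (N.submatrix r (Fin.castLE (Nat.lt_succ_iff.1 k.isLt))).det

theorem map_prodLeadingColumnMinors {R S : Type*} [CommRing R] [CommRing S] (φ : R →+* S)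
    {n : ℕ} (N : Matrix (Fin n) (Fin n) R) :
    φ (prodLeadingColumnMinors N) = prodLeadingColumnMinors (φ.mapMatrix N) := by
  simp only [prodLeadingColumnMinors, map_prod, RingHom.map_det]
  rfl

theorem consecutiveMinorsNeZero_of_prod_ne_zero {n : ℕ} {N : Matrix (Fin n) (Fin n) ℂ}
    (hN : prodLeadingColumnMinors N ≠ 0) : ConsecutiveMinorsNeZero 0 N := by
  intro k i r c _ hr hc
  have hinj : Function.Injective r := fun a b hab => by
    have := hr a
    have := hr b
    rw [hab] at *
    exact Fin.ext (by omega)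
  have hk : k ≤ n := by simpa using Fintype.card_le_of_injective r hinj
  have hceq : c = Fin.castLE hk := funext fun a => Fin.ext (by simp [hc])
  rw [prodLeadingColumnMinors, Finset.prod_ne_zero_iff] at hN
  have h := Finset.prod_ne_zero_iff.1
    (hN ⟨k, Nat.lt_succ_iff.2 hk⟩ (Finset.mem_univ _)) ⟨r, hinj⟩ (Finset.mem_univ _)
  rw [hceq]
  exact h

theorem prodLeadingColumnMinors_smul_vandermonde_ne_zero {n : ℕ} {a : ℂ} (ha : a ≠ 0)
    {v : Fin n → ℂ} (hv : Function.Injective v) :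
    prodLeadingColumnMinors (a • vandermonde v) ≠ 0 := by
  refine Finset.prod_ne_zero_iff.2 fun k _ => Finset.prod_ne_zero_iff.2 fun r _ => ?_
  have : (a • vandermonde v).submatrix r (Fin.castLE (Nat.lt_succ_iff.1 k.isLt)) =
      a • vandermonde (v ∘ r) := by
    ext i j
    simp [vandermonde_apply]
  rw [this, det_smul]
  exact mul_ne_zero (pow_ne_zero _ ha) (det_vandermonde_ne_zero_iff.2 (hv.comp r.injective))

theorem exists_adjugate_eq_smul {n : ℕ} {B : Matrix (Fin n) (Fin n) ℂ} (hB : B.det ≠ 0) :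
    ∃ (A : Matrix (Fin n) (Fin n) ℂ) (a : ℂ), A.det ≠ 0 ∧ a ≠ 0 ∧ A.adjugate = a • B := by
  have hu : IsUnit B.det := hB.isUnit
  have hdet : B⁻¹.det ≠ 0 := (isUnit_nonsing_inv_det B hu).ne_zero
  refine ⟨B⁻¹, B⁻¹.det, hdet, hdet, ?_⟩
  calc B⁻¹.adjugate = B⁻¹.adjugate * (B⁻¹ * B) := by rw [nonsing_inv_mul B hu, Matrix.mul_one]
    _ = B⁻¹.det • B := by rw [← Matrix.mul_assoc, adjugate_mul, smul_mul, Matrix.one_mul]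

/-- There exists a nonzero polynomial `P` in the matrix entries such that
every `n×n` complex matrix `A` with `P(A) ≠ 0` is a product of `n` upper bidiagonal
matrices followed by `n` lower bidiagonal matrices. -/
theorem stmt4 (n : ℕ) :
    ∃ P : MvPolynomial (Fin n × Fin n) ℂ, P ≠ 0 ∧
      ∀ A : Matrix (Fin n) (Fin n) ℂ,
        MvPolynomial.eval (fun p => A p.1 p.2) P ≠ 0 →
        ∃ f g : Fin n → Matrix (Fin n) (Fin n) ℂ,
          (∀ i, IsUpperBidiagonal n (f i)) ∧ (∀ i, IsLowerBidiagonal n (g i)) ∧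
          A = (List.ofFn f).prod * (List.ofFn g).prod := by
  let X := mvPolynomialX (Fin n) (Fin n) ℂ
  have hX (A : Matrix (Fin n) (Fin n) ℂ) :
      (MvPolynomial.eval fun p : Fin n × Fin n => A p.1 p.2).mapMatrix X = A :=
    mvPolynomialX_mapMatrix_eval A
  have hdet (A : Matrix (Fin n) (Fin n) ℂ) :
      MvPolynomial.eval (fun p => A p.1 p.2) X.det = A.det := by
    rw [RingHom.map_det, hX]
  have hadj (A : Matrix (Fin n) (Fin n) ℂ) :
      MvPolynomial.eval (fun p => A p.1 p.2) (prodLeadingColumnMinors X.adjugate) =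
        prodLeadingColumnMinors A.adjugate := by
    rw [map_prodLeadingColumnMinors, RingHom.map_adjugate, hX]
  have hadjT (A : Matrix (Fin n) (Fin n) ℂ) :
      MvPolynomial.eval (fun p => A p.1 p.2) (prodLeadingColumnMinors X.adjugateᵀ) =
        prodLeadingColumnMinors A.adjugateᵀ := by
    rw [map_prodLeadingColumnMinors, adjugate_transpose, RingHom.map_adjugate,
      adjugate_transpose, RingHom.mapMatrix_apply, transpose_map, ← RingHom.mapMatrix_apply, hX]
  let v : Fin n → ℂ := fun i => (i : ℕ)
  have hv : Function.Injective v := fun i j hij => Fin.ext (Nat.cast_injective hij)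
  obtain ⟨A, a, hA, ha, hAadj⟩ := exists_adjugate_eq_smul (det_vandermonde_ne_zero_iff.2 hv)
  refine ⟨X.det * prodLeadingColumnMinors X.adjugate * prodLeadingColumnMinors X.adjugateᵀ,
    mul_ne_zero (mul_ne_zero ?_ ?_) ?_, fun B hB => ?_⟩
  · intro h
    apply hA
    rw [← hdet, h, map_zero]
  · intro h
    apply prodLeadingColumnMinors_smul_vandermonde_ne_zero ha hv
    rw [← hAadj, ← hadj, h, map_zero]
  · intro h
    apply prodLeadingColumnMinors_smul_vandermonde_ne_zero ha hv
    rw [← hAadj, ← transpose_transpose A.adjugate, adjugate_transpose, ← hadjT, h, map_zero]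
  · rw [map_mul, map_mul, hdet, hadj, hadjT] at hB
    exact exists_bidiagonal_factorization (left_ne_zero_of_mul (left_ne_zero_of_mul hB))
      (consecutiveMinorsNeZero_of_prod_ne_zero (right_ne_zero_of_mul (left_ne_zero_of_mul hB)))
      (consecutiveMinorsNeZero_of_prod_ne_zero (right_ne_zero_of_mul hB))
end

section
/- Every n×n complex matrix is a product of 8n bidiagonal matrices. -/
/-- An `n×n` matrix is bidiagonal (2-diagonal): `A i j = 0` whenever `|i - j| ≥ 2`. -/
def IsBidiagonal (n : ℕ) (A : Matrix (Fin n) (Fin n) ℂ) : Prop :=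
  ∀ i j : Fin n, ((i : ℤ) - (j : ℤ)).natAbs ≥ 2 → A i j = 0

open Matrix

/-- Upper triangular with ones on the diagonal. -/
def IsUnitUpper {n : ℕ} (T : Matrix (Fin n) (Fin n) ℂ) : Prop :=
  (∀ i, T i i = 1) ∧ ∀ i j, j < i → T i j = 0

/-- `A` is a product of exactly `k` bidiagonal matrices. -/
def IsBidiagonalProd (n k : ℕ) (A : Matrix (Fin n) (Fin n) ℂ) : Prop :=
  ∃ l : List (Matrix (Fin n) (Fin n) ℂ),
    l.length = k ∧ (∀ X ∈ l, IsBidiagonal n X) ∧ l.prod = A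

namespace IsBidiagonalProd

variable {n k m : ℕ} {A B : Matrix (Fin n) (Fin n) ℂ}

lemma of_isBidiagonal (h : IsBidiagonal n A) : IsBidiagonalProd n 1 A :=
  ⟨[A], by simp, by simpa using h, by simp⟩

lemma mul (hA : IsBidiagonalProd n k A) (hB : IsBidiagonalProd n m B) :
    IsBidiagonalProd n (k + m) (A * B) := by
  obtain ⟨l, hl, hl', rfl⟩ := hA
  obtain ⟨r, hr, hr', rfl⟩ := hB
  refine ⟨l ++ r, by simp [hl, hr], fun X hX => ?_, by simp⟩
  rcases List.mem_append.1 hX with h | h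
  exacts [hl' X h, hr' X h]

lemma transpose (hA : IsBidiagonalProd n k A) : IsBidiagonalProd n k Aᵀ := by
  obtain ⟨l, hl, hl', rfl⟩ := hA
  refine ⟨(l.map Matrix.transpose).reverse, by simp [hl], fun X hX => ?_, ?_⟩
  · simp only [List.mem_reverse, List.mem_map] at hX
    obtain ⟨Y, hY, rfl⟩ := hX
    exact fun i j hij => hl' Y hY j i (by omega)
  · rw [Matrix.transpose_list_prod]

end IsBidiagonalProd

lemma isBidiagonal_diagonal {n : ℕ} (d : Fin n → ℂ) : IsBidiagonal n (diagonal d) := by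
  intro i j hij
  refine diagonal_apply_ne _ ?_
  rintro rfl
  simp at hij

lemma IsBidiagonalProd.mono {n k m : ℕ} {A : Matrix (Fin n) (Fin n) ℂ}
    (hA : IsBidiagonalProd n k A) (h : k ≤ m) : IsBidiagonalProd n m A := by
  induction m, h using Nat.le_induction with
  | base => exact hA
  | succ m _ ih =>
    simpa using ih.mul (.of_isBidiagonal (isBidiagonal_diagonal (fun _ : Fin n => (1 : ℂ))))

/-! ### Sorting networks and unit triangular matrices -/

/-- The matrix `M`, with columns permuted by `w`, is unit upper triangular, and its entries at the
inversions of `w` vanish. -/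
def IsSortedPattern {n : ℕ} (w : Fin n → Fin n) (M : Matrix (Fin n) (Fin n) ℂ) : Prop :=
  (∀ p, M p (w p) = 1) ∧ (∀ p q, q < p → M p (w q) = 0) ∧
    ∀ p q, p < q → w q < w p → M p (w q) = 0

/-- One layer of adjacent exchanges: a matrix with pattern `w` is a bidiagonal matrix times a matrix
with pattern `w ∘ σ`. -/
lemma IsSortedPattern.exists_layer {n : ℕ} {w σ : Fin n → Fin n} {M : Matrix (Fin n) (Fin n) ℂ}
    (hM : IsSortedPattern w M) (hσ : ∀ p, σ (σ p) = p)
    (hadj : ∀ p, (σ p : ℕ) ≤ p + 1 ∧ (p : ℕ) ≤ σ p + 1)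
    (hw : ∀ p, p < σ p → w p < w (σ p)) :
    ∃ X M', IsBidiagonal n X ∧ M = X * M' ∧ IsSortedPattern (w ∘ σ) M' := by
  obtain ⟨h1, h2, h3⟩ := hM
  set d : Fin n → ℂ := fun p => if p < σ p then M p (w (σ p)) else 0 with hd
  have hd0 : ∀ p, ¬ p < σ p → d p = 0 := fun p hp => by simp [hd, hp]
  have hd1 : ∀ p, p < σ p → d p = M p (w (σ p)) := fun p hp => by simp [hd, hp]
  have hdd : ∀ p, d p * d (σ p) = 0 := by
    intro p
    by_cases hp : p < σ p
    · rw [hd0 (σ p) (by rw [hσ]; exact hp.asymm), mul_zero]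
    · rw [hd0 p hp, zero_mul]
  refine ⟨of fun p r => (if r = σ p then 1 else 0) + (if r = p then d p else 0),
    of fun p k => M (σ p) k - d (σ p) * M p k, ?_, ?_, ?_, ?_, ?_⟩
  · intro i j hij
    have := hadj i
    have hj : j ≠ σ i := by rintro rfl; omega
    have hj' : j ≠ i := by rintro rfl; omega
    simp [hj, hj']
  · ext p k
    simp only [mul_apply, of_apply, add_mul, ite_mul, one_mul, zero_mul, Finset.sum_add_distrib,
      Finset.sum_ite_eq', Finset.mem_univ, if_true, hσ]
    linear_combination (M p k) * hdd p
  · intro p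
    simp only [of_apply, Function.comp_apply, h1]
    by_cases hp : σ p < p
    · rw [h2 p (σ p) hp]; simp
    · rw [hd0 (σ p) (by rwa [hσ])]; simp
  · intro p q hqp
    simp only [of_apply, Function.comp_apply]
    have hp := hadj p
    have hq := hadj q
    rcases lt_trichotomy (σ q) (σ p) with h | h | h
    · rw [h2 _ _ h]
      by_cases hp' : σ p < p
      · rw [h2 p (σ q) (h.trans hp')]; simp
      · rw [hd0 (σ p) (by rwa [hσ])]; simp
    · have : q = p := by rw [← hσ q, h, hσ]
      exact absurd this hqp.ne
    · have hpq : σ p = q := by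
        apply Fin.ext; simp only [Fin.lt_def] at *; omega
      have hqp' : σ q = p := by rw [← hpq, hσ]
      rw [hpq, hqp', hd1 q (by rwa [hqp']), hqp', h1]; simp
  · intro p q hpq hwpq
    simp only [of_apply, Function.comp_apply] at *
    have hp := hadj p
    have hq := hadj q
    have hfst : M (σ p) (w (σ q)) = 0 := by
      rcases lt_trichotomy (σ q) (σ p) with h | h | h
      · exact h2 _ _ h
      · rw [h] at hwpq; exact absurd hwpq (lt_irrefl _)
      · exact h3 _ _ h hwpq
    rw [hfst]
    by_cases hp' : σ p < p
    · have hne : σ q ≠ p := by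
        intro h
        have : q = σ p := by rw [← h, hσ]
        exact absurd (this ▸ hpq) hp'.asymm
      have hlt : p < σ q := by
        rw [Ne, Fin.ext_iff] at hne
        simp only [Fin.lt_def] at *; omega
      have := hw (σ p) (by rwa [hσ])
      rw [hσ] at this
      rw [h3 p (σ q) hlt (hwpq.trans this)]; simp
    · rw [hd0 (σ p) (by rwa [hσ])]; simp

/-- The exchanges made by odd-even transposition sort at time `t`. -/
def oddEvenSwap (n t : ℕ) (p : Fin n) : Fin n :=
  if h : (p + t) % 2 = 0 then
    (if h' : (p : ℕ) + 1 < n then ⟨p + 1, h'⟩ else p)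
  else ⟨p - 1, by omega⟩

/-- The item at position `p` at time `t` when odd-even transposition sort reverses `n` items. -/
def oddEvenItem (n t : ℕ) (p : ℕ) : ℕ :=
  if (p + t) % 2 = 0 then (if t ≤ p then p - t else t - p - 1)
  else (if p + t < n then p + t else 2 * n - 1 - p - t)

lemma oddEvenItem_lt {n t p : ℕ} (ht : t ≤ n) (hp : p < n) : oddEvenItem n t p < n := by
  unfold oddEvenItem; split_ifs <;> omega

lemma oddEvenItem_swap {n t : ℕ} (ht : t < n) (p : Fin n) :
    oddEvenItem n (t + 1) p = oddEvenItem n t (oddEvenSwap n t p) := by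
  have := p.isLt
  unfold oddEvenItem oddEvenSwap
  split_ifs <;> (try simp only at *) <;> omega

lemma oddEvenSwap_involutive {n t : ℕ} (p : Fin n) :
    oddEvenSwap n t (oddEvenSwap n t p) = p := by
  have := p.isLt
  apply Fin.ext
  unfold oddEvenSwap
  split_ifs <;> (try simp only at *) <;> omega

lemma oddEvenSwap_adjacent {n t : ℕ} (p : Fin n) :
    (oddEvenSwap n t p : ℕ) ≤ p + 1 ∧ (p : ℕ) ≤ oddEvenSwap n t p + 1 := by
  unfold oddEvenSwap
  split_ifs <;> (try simp only at *) <;> omega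

lemma oddEvenItem_lt_swap {n t : ℕ} (ht : t < n) (p : Fin n) (h : p < oddEvenSwap n t p) :
    oddEvenItem n t p < oddEvenItem n t (oddEvenSwap n t p) := by
  have := p.isLt
  rw [Fin.lt_def] at h
  unfold oddEvenItem oddEvenSwap at *
  split_ifs at * <;> (try simp only at *) <;> omega

/-- The permutation matrix of the order reversal. -/
def reversalMatrix (n : ℕ) : Matrix (Fin n) (Fin n) ℂ :=
  of fun i j => if j = i.rev then 1 else 0

lemma reversalMatrix_transpose (n : ℕ) : (reversalMatrix n)ᵀ = reversalMatrix n := by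
  ext i j
  simp only [reversalMatrix, transpose_apply, of_apply]
  congr 1
  rw [eq_iff_iff, Fin.ext_iff, Fin.ext_iff, Fin.val_rev, Fin.val_rev]
  omega

lemma reversalMatrix_mul_self (n : ℕ) : reversalMatrix n * reversalMatrix n = 1 := by
  ext i j
  simp only [reversalMatrix, mul_apply, of_apply, ite_mul, one_mul, zero_mul, Finset.sum_ite_eq',
    Finset.mem_univ, if_true, Fin.rev_rev, one_apply, eq_comm (a := j)]

lemma IsUnitUpper.isBidiagonalProd_mul_reversal {n : ℕ} {T : Matrix (Fin n) (Fin n) ℂ}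
    (hT : IsUnitUpper T) : IsBidiagonalProd n n (T * reversalMatrix n) := by
  have key : ∀ t (ht : t ≤ n), ∃ P M, IsBidiagonalProd n t P ∧ T = P * M ∧
      IsSortedPattern (fun p : Fin n => ⟨oddEvenItem n t p, oddEvenItem_lt ht p.isLt⟩) M := by
    intro t
    induction t with
    | zero =>
      intro ht
      have hid : (fun p : Fin n => (⟨oddEvenItem n 0 p, oddEvenItem_lt ht p.isLt⟩ : Fin n))
          = id := by
        funext p
        apply Fin.ext
        simp [oddEvenItem]
      rw [hid]
      exact ⟨1, T, ⟨[], by simp⟩, by simp, hT.1, hT.2,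
        fun p q h h' => absurd h h'.asymm⟩
    | succ t ih =>
      intro ht
      obtain ⟨P, M, hP, rfl, hM⟩ := ih (by omega)
      obtain ⟨X, M', hX, rfl, hM'⟩ := hM.exists_layer (σ := oddEvenSwap n t)
        oddEvenSwap_involutive oddEvenSwap_adjacent (fun p hp => oddEvenItem_lt_swap ht p hp)
      refine ⟨P * X, M', hP.mul (.of_isBidiagonal hX), (mul_assoc ..).symm, ?_⟩
      convert hM' using 1
      funext p
      exact Fin.ext (oddEvenItem_swap ht p)
  obtain ⟨P, M, hP, rfl, h1, h2, h3⟩ := key n le_rfl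
  have hrev : ∀ p : Fin n,
      (⟨oddEvenItem n n p, oddEvenItem_lt le_rfl p.isLt⟩ : Fin n) = p.rev := by
    intro p
    have := p.isLt
    apply Fin.ext
    simp only [Fin.val_rev]
    unfold oddEvenItem; split_ifs <;> omega
  simp only [hrev] at h1 h2 h3
  have hM : M = reversalMatrix n := by
    ext p k
    obtain ⟨q, rfl⟩ := Fin.rev_surjective k
    simp only [reversalMatrix, of_apply, Fin.rev_inj]
    rcases lt_trichotomy p q with h | rfl | h
    · rw [if_neg h.ne', h3 p q h (Fin.rev_lt_rev.2 h)]
    · rw [if_pos rfl, h1]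
    · rw [if_neg h.ne, h2 p q h]
  rwa [hM, mul_assoc, reversalMatrix_mul_self, mul_one]

lemma IsUnitUpper.isBidiagonalProd_mul {n : ℕ} {U L : Matrix (Fin n) (Fin n) ℂ}
    (hU : IsUnitUpper U) (hL : IsUnitUpper Lᵀ) : IsBidiagonalProd n (n + n) (U * L) := by
  have h := hU.isBidiagonalProd_mul_reversal.mul hL.isBidiagonalProd_mul_reversal.transpose
  rwa [transpose_mul, transpose_transpose, reversalMatrix_transpose, mul_assoc,
    ← mul_assoc (reversalMatrix n), reversalMatrix_mul_self, one_mul] at h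

/-! ### Factorization into unit triangular matrices -/

/-- The matrix with corner `a`, first row `r`, first column `c` and remaining block `B`. -/
def borderMatrix {n : ℕ} (a : ℂ) (r c : Fin n → ℂ) (B : Matrix (Fin n) (Fin n) ℂ) :
    Matrix (Fin (n + 1)) (Fin (n + 1)) ℂ :=
  of (Fin.cons (Fin.cons a r) fun i => Fin.cons (c i) (B i))

section borderMatrix

variable {n : ℕ} (a a' : ℂ) (r c r' c' : Fin n → ℂ) (B B' : Matrix (Fin n) (Fin n) ℂ)

@[simp] lemma borderMatrix_zero_zero : borderMatrix a r c B 0 0 = a := rfl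
@[simp] lemma borderMatrix_zero_succ (j : Fin n) : borderMatrix a r c B 0 j.succ = r j := rfl
@[simp] lemma borderMatrix_succ_zero (i : Fin n) : borderMatrix a r c B i.succ 0 = c i := rfl
@[simp] lemma borderMatrix_succ_succ (i j : Fin n) :
    borderMatrix a r c B i.succ j.succ = B i j := rfl

lemma borderMatrix_mul : borderMatrix a r c B * borderMatrix a' r' c' B' =
    borderMatrix (a * a' + r ⬝ᵥ c') (a • r' + r ᵥ* B') (a' • c + B *ᵥ c')
      (vecMulVec c r' + B * B') := by
  ext i j
  refine Fin.cases ?_ (fun i => ?_) i <;> refine Fin.cases ?_ (fun j => ?_) j <;>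
    simp [mul_apply, Fin.sum_univ_succ, dotProduct, vecMul, mulVec, vecMulVec_apply, mul_comm]

lemma borderMatrix_transpose : (borderMatrix a r c B)ᵀ = borderMatrix a c r Bᵀ := by
  ext i j
  refine Fin.cases ?_ (fun i => ?_) i <;> refine Fin.cases ?_ (fun j => ?_) j <;> simp

lemma borderMatrix_one_eq_one : borderMatrix 1 0 0 (1 : Matrix (Fin n) (Fin n) ℂ) = 1 := by
  ext i j
  refine Fin.cases ?_ (fun i => ?_) i <;> refine Fin.cases ?_ (fun j => ?_) j <;>
    simp [one_apply, Fin.succ_ne_zero, (Fin.succ_ne_zero _).symm]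

lemma exists_eq_borderMatrix (A : Matrix (Fin (n + 1)) (Fin (n + 1)) ℂ) :
    ∃ a r c B, A = borderMatrix a r c B := by
  refine ⟨A 0 0, fun j => A 0 j.succ, fun i => A i.succ 0, A.submatrix Fin.succ Fin.succ, ?_⟩
  ext i j
  refine Fin.cases ?_ (fun i => ?_) i <;> refine Fin.cases ?_ (fun j => ?_) j <;> simp

lemma IsUnitUpper.borderMatrix {U : Matrix (Fin n) (Fin n) ℂ} (hU : IsUnitUpper U) :
    IsUnitUpper (borderMatrix 1 r 0 U) := by
  constructor
  · intro i
    refine Fin.cases ?_ (fun i => ?_) i <;> simp [hU.1]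
  · intro i j
    refine Fin.cases ?_ (fun i => ?_) i <;> refine Fin.cases ?_ (fun j => ?_) j <;>
      simp +contextual [hU.2]

end borderMatrix

lemma IsUnitUpper.isUnit_det {n : ℕ} {U : Matrix (Fin n) (Fin n) ℂ} (hU : IsUnitUpper U) :
    IsUnit U.det := by
  rw [det_of_isUpperTriangular (fun i j h => hU.2 i j h)]
  simp [hU.1]

/-- `A` is a product `U₁ L₁ D U₂ L₂` of unit upper, unit lower and diagonal matrices. -/
def HasULDUL {n : ℕ} (A : Matrix (Fin n) (Fin n) ℂ) : Prop :=
  ∃ U₁ L₁ U₂ L₂ : Matrix (Fin n) (Fin n) ℂ, ∃ d : Fin n → ℂ,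
    IsUnitUpper U₁ ∧ IsUnitUpper L₁ᵀ ∧ IsUnitUpper U₂ ∧ IsUnitUpper L₂ᵀ ∧
      A = U₁ * L₁ * diagonal d * U₂ * L₂

lemma borderMatrix_diagonal {n : ℕ} (a : ℂ) (d : Fin n → ℂ) :
    borderMatrix a 0 0 (diagonal d) = diagonal (Fin.cons a d : Fin (n + 1) → ℂ) := by
  ext i j
  refine Fin.cases ?_ (fun i => ?_) i <;> refine Fin.cases ?_ (fun j => ?_) j <;>
    simp [diagonal_apply, Fin.succ_ne_zero, (Fin.succ_ne_zero _).symm]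

/-- A bordered matrix with invertible corner, or with trivial border, may be factored through its
Schur complement, also after transvections of the first row from the left and of the first column
from the right. -/
lemma HasULDUL.borderMatrix {n : ℕ} {S : Matrix (Fin n) (Fin n) ℂ} (hS : HasULDUL S)
    (a : ℂ) (l r u v : Fin n → ℂ) :
    HasULDUL (borderMatrix 1 u 0 1 * borderMatrix a (a • r) (a • l) (a • vecMulVec l r + S) *
      borderMatrix 1 0 v 1) := by
  obtain ⟨U₁, L₁, U₂, L₂, d, hU₁, hL₁, hU₂, hL₂, rfl⟩ := hS
  have hi₁ : U₁ * U₁⁻¹ = 1 := mul_nonsing_inv _ hU₁.isUnit_det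
  have hi₂ : L₂⁻¹ * L₂ = 1 :=
    nonsing_inv_mul _ (by simpa using hL₂.isUnit_det)
  refine ⟨_root_.borderMatrix 1 (u ᵥ* U₁) 0 U₁, _root_.borderMatrix 1 0 (U₁⁻¹ *ᵥ l) L₁,
    _root_.borderMatrix 1 (r ᵥ* L₂⁻¹) 0 U₂, _root_.borderMatrix 1 0 (L₂ *ᵥ v) L₂, Fin.cons a d,
    hU₁.borderMatrix _, ?_, hU₂.borderMatrix _, ?_, ?_⟩
  · rw [borderMatrix_transpose]; exact hL₁.borderMatrix _
  · rw [borderMatrix_transpose]; exact hL₂.borderMatrix _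
  have e₁ : _root_.borderMatrix 1 (u ᵥ* U₁) 0 U₁ =
      _root_.borderMatrix 1 u 0 1 * _root_.borderMatrix 1 0 0 U₁ := by
    simp [borderMatrix_mul]
  have e₂ : _root_.borderMatrix 1 0 (L₂ *ᵥ v) L₂ =
      _root_.borderMatrix 1 0 0 L₂ * _root_.borderMatrix 1 0 v 1 := by
    simp [borderMatrix_mul]
  rw [e₁, e₂, ← borderMatrix_diagonal]
  simp only [← mul_assoc]
  congr 1
  simp only [mul_assoc]
  congr 1
  simp [borderMatrix_mul, ← mul_assoc, mulVec_smul, mulVec_mulVec, vecMul_vecMul, hi₁, hi₂,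
    mul_add, mul_vecMulVec]

lemma hasULDUL_borderMatrix_of_ne_zero {n : ℕ}
    (ih : ∀ S : Matrix (Fin n) (Fin n) ℂ, HasULDUL S) {a : ℂ} (ha : a ≠ 0)
    (r c u v : Fin n → ℂ) (B : Matrix (Fin n) (Fin n) ℂ) :
    HasULDUL (borderMatrix 1 u 0 1 * borderMatrix a r c B * borderMatrix 1 0 v 1) := by
  have h := (ih (B - a • vecMulVec (a⁻¹ • c) (a⁻¹ • r))).borderMatrix a (a⁻¹ • c) (a⁻¹ • r) u v
  rwa [smul_inv_smul₀ ha, smul_inv_smul₀ ha, add_sub_cancel] at h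

theorem hasULDUL {n : ℕ} (A : Matrix (Fin n) (Fin n) ℂ) : HasULDUL A := by
  induction n with
  | zero =>
    exact ⟨1, 1, 1, 1, 0, ⟨nofun, nofun⟩, ⟨nofun, nofun⟩, ⟨nofun, nofun⟩, ⟨nofun, nofun⟩,
      Subsingleton.elim _ _⟩
  | succ n ih =>
    obtain ⟨a, r, c, B, rfl⟩ := exists_eq_borderMatrix A
    by_cases ha : a = 0
    · subst ha
      by_cases hr : r = 0
      · subst hr
        by_cases hc : c = 0
        · subst hc
          simpa [borderMatrix_one_eq_one] using (ih B).borderMatrix 0 0 0 0 0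
        · obtain ⟨i, hi⟩ := Function.ne_iff.1 hc
          have h := hasULDUL_borderMatrix_of_ne_zero ih hi (B i) c (-Pi.single i 1) 0 B
          simpa [borderMatrix_mul, neg_vecMul, row_def] using h
      · obtain ⟨j, hj⟩ := Function.ne_iff.1 hr
        have h := hasULDUL_borderMatrix_of_ne_zero ih hj r (c + B.col j) 0 (-Pi.single j 1) B
        simpa [borderMatrix_mul, mulVec_neg] using h
    · simpa [borderMatrix_one_eq_one] using hasULDUL_borderMatrix_of_ne_zero ih ha r c 0 0 B

/-- Every `n×n` complex matrix is a product of `8n` bidiagonal matrices. -/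
theorem stmt6 (n : ℕ) (A : Matrix (Fin n) (Fin n) ℂ) :
    ∃ f : Fin (8 * n) → Matrix (Fin n) (Fin n) ℂ,
      (∀ i, IsBidiagonal n (f i)) ∧ A = (List.ofFn f).prod := by
  rcases Nat.eq_zero_or_pos n with rfl | hn
  · exact ⟨nofun, nofun, Subsingleton.elim _ _⟩
  obtain ⟨U₁, L₁, U₂, L₂, d, hU₁, hL₁, hU₂, hL₂, rfl⟩ := hasULDUL A
  have h := ((hU₁.isBidiagonalProd_mul hL₁).mul (.of_isBidiagonal (isBidiagonal_diagonal d))).mul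
    (hU₂.isBidiagonalProd_mul hL₂)
  obtain ⟨l, hl, hl', hprod⟩ := h.mono (show _ ≤ 8 * n by omega)
  rw [← hl]
  exact ⟨l.get, fun i => hl' _ (l.get_mem i), by rw [List.ofFn_get, hprod, ← mul_assoc]⟩
end
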